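/- arXiv:1303.4812 — 3 statements merged into one kernel-verified Lean document; each statement's English description precedes it below -/
import Mathlib

section
/- Let d ≥ 2 and s ≥ 1 be integers, and for each i ∈ {1,…,s} let μᵢ be a partition of d, encoded by the multiset mᵢ of those parts of μᵢ that are at least 2 (so each mᵢ is a multiset of integers ≥ 2 whose sum is at most d). Then there exist a natural number R and permutations σ₁,…,σ_s and τ₁,…,τ_R of a d-element set such that: (i) for each i, the cycle type of σᵢ equals mᵢ; (ii) each τⱼ is a transposition; (iii) the ordered product σ₁ ⋯ σ_s · τ₁ ⋯ τ_R equals the identity; and (iv) the subgroup generated by σ₁,…,σ_s, τ₁,…,τ_R is the full symmetric group on d letters (in particular, it is transitive). -/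
/-- Every permutation of a finite type is the product of a list of transpositions that contains
every transposition at least once. -/
theorem Equiv.Perm.exists_list_isSwap_prod_eq {α : Type*} [Fintype α] [DecidableEq α]
    (g : Equiv.Perm α) :
    ∃ l : List (Equiv.Perm α), l.prod = g ∧ ∀ t, t ∈ l ↔ t.IsSwap := by
  classical
  let l₀ := (Finset.univ.filter fun t : Equiv.Perm α => t.IsSwap).toList
  obtain ⟨l, hl, hl'⟩ := (Equiv.Perm.truncSwapFactors (l₀.prod⁻¹ * g)).out
  refine ⟨l₀ ++ l, by simp [hl], fun t => ?_⟩
  have h₀ : t ∈ l₀ ↔ t.IsSwap := by simp [l₀]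
  rw [List.mem_append, h₀]
  exact or_iff_left_of_imp (hl' t)

/-- For `d ≥ 2`, `s ≥ 1` and partitions `μ₁, …, μ_s` of `d` (each encoded by the
multiset `m i` of its parts that are `≥ 2`), there exist `R : ℕ` and permutations
`σ₁, …, σ_s` with the prescribed cycle types, together with `R` transpositions
`τ₁, …, τ_R`, whose ordered product is the identity and which generate the full
symmetric group on `d` letters (in particular a transitive subgroup).  This is the
group-theoretic statement of the non-emptiness of the Hurwitz sets
`H^d_{g',0}(μ₁, …, μ_s)` for sufficiently large `g'`. -/
theorem hurwitz_factorization_exists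
    (d s : ℕ) (hd : 2 ≤ d) (hs : 1 ≤ s)
    (m : Fin s → Multiset ℕ)
    (hm2 : ∀ i, ∀ x ∈ m i, 2 ≤ x)
    (hmsum : ∀ i, (m i).sum ≤ d) :
    ∃ (R : ℕ) (σ : Fin s → Equiv.Perm (Fin d)) (τ : Fin R → Equiv.Perm (Fin d)),
      (∀ i, (σ i).cycleType = m i) ∧
      (∀ j, (τ j).IsSwap) ∧
      (List.ofFn σ).prod * (List.ofFn τ).prod = 1 ∧
      Subgroup.closure (Set.range σ ∪ Set.range τ) = ⊤ := by
  have hσ : ∀ i, ∃ g : Equiv.Perm (Fin d), g.cycleType = m i := fun i =>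
    (Equiv.Perm.exists_with_cycleType_iff (Fin d)).mpr
      ⟨by simpa using hmsum i, hm2 i⟩
  choose σ hσ using hσ
  obtain ⟨l, hl, hswap⟩ := Equiv.Perm.exists_list_isSwap_prod_eq (List.ofFn σ).prod⁻¹
  refine ⟨l.length, σ, l.get, hσ, fun j => (hswap _).1 (l.get_mem j), ?_, ?_⟩
  · rw [List.ofFn_get, hl, mul_inv_cancel]
  · rw [eq_top_iff, ← Equiv.Perm.closure_isSwap]
    refine Subgroup.closure_mono fun t ht => Or.inr ?_
    exact List.mem_iff_get.1 ((hswap t).2 ht)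
end

section
/- Let d ≥ 2 and s ≥ 1 be integers, and for each i ∈ {1,…,s} let μᵢ be a partition of d, encoded by the multiset mᵢ of those parts of μᵢ that are at least 2 (so each mᵢ is a multiset of integers ≥ 2 whose sum is at most d). Set R = 2d + Σᵢ (sum of mᵢ − number of elements of mᵢ) (equivalently, R = 2d + Σᵢ (d − ℓ(μᵢ)), where ℓ(μᵢ) is the number of parts of μᵢ counting parts equal to 1). Then there exist permutations σ₁,…,σ_s and τ₁,…,τ_R of a d-element set such that: (i) for each i, the cycle type of σᵢ equals mᵢ; (ii) each τⱼ is a transposition; (iii) the ordered product σ₁ ⋯ σ_s · τ₁ ⋯ τ_R equals the identity; and (iv) the subgroup generated by σ₁,…,σ_s, τ₁,…,τ_R is the full symmetric group on d letters. -/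
namespace Equiv.Perm

/-- A cycle of length `n` is a product of `n - 1` transpositions. -/
theorem IsCycle.exists_list_isSwap {α : Type*} [Fintype α] [DecidableEq α] {f : Perm α}
    (hf : f.IsCycle) :
    ∃ l : List (Perm α), (∀ g ∈ l, g.IsSwap) ∧ l.prod = f ∧ l.length = f.support.card - 1 := by
  obtain ⟨x, hx, -⟩ := id hf
  have hnodup : (f.toList x).Nodup := nodup_toList f x
  refine ⟨List.zipWith swap (f.toList x) (f.toList x).tail, ?_, ?_, ?_⟩
  · intro g hg
    obtain ⟨i, hi, rfl⟩ := List.mem_iff_getElem.1 hg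
    simp only [List.length_zipWith, List.length_tail] at hi
    simp only [List.getElem_zipWith, List.getElem_tail]
    rw [swap_isSwap_iff, Ne, hnodup.getElem_inj_iff]
    omega
  · exact (formPerm_toList f x).trans (hf.cycleOf_eq hx)
  · simp [length_toList, hf.cycleOf_eq hx]

theorem card_cycleType_le_sum {α : Type*} [Fintype α] [DecidableEq α] (f : Perm α) :
    Multiset.card f.cycleType ≤ f.cycleType.sum := by
  simpa using Multiset.card_nsmul_le_sum (s := f.cycleType) (a := 1)
    fun _ hx => (one_lt_of_mem_cycleType hx).le

/-- Every permutation `f` is a product of `∑ (ℓ - 1)` transpositions, where `ℓ` runs over the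
lengths of the nontrivial cycles of `f`. -/
theorem exists_list_isSwap {α : Type*} [Fintype α] [DecidableEq α] (f : Perm α) :
    ∃ l : List (Perm α), (∀ g ∈ l, g.IsSwap) ∧ l.prod = f ∧
      l.length = f.cycleType.sum - Multiset.card f.cycleType := by
  induction f using cycle_induction_on with
  | base_one => exact ⟨[], by simp⟩
  | base_cycles f hf =>
    obtain ⟨l, hl, hprod, hlen⟩ := hf.exists_list_isSwap
    exact ⟨l, hl, hprod, by simp [hlen, hf.cycleType]⟩
  | induction_disjoint f g hfg _ ihf ihg =>
    obtain ⟨l, hl, hprod, hlen⟩ := ihf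
    obtain ⟨l', hl', hprod', hlen'⟩ := ihg
    refine ⟨l ++ l', ?_, by simp [hprod, hprod'], ?_⟩
    · simpa [or_imp, forall_and] using ⟨hl, hl'⟩
    · have := card_cycleType_le_sum f
      have := card_cycleType_le_sum g
      rw [hfg.cycleType_mul, Multiset.sum_add, Multiset.card_add, List.length_append]
      omega

theorem IsSwap.mul_self {α : Type*} [DecidableEq α] {f : Perm α} (hf : f.IsSwap) : f * f = 1 := by
  obtain ⟨x, y, -, rfl⟩ := hf
  exact swap_mul_self x y

/-- The inverse of the ordered product of a tuple of permutations is a product of transpositions,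
with the number of factors determined by the cycle types. -/
theorem exists_list_isSwap_prod_ofFn_inv {α : Type*} [Fintype α] [DecidableEq α] {s : ℕ}
    (σ : Fin s → Perm α) :
    ∃ l : List (Perm α), (∀ g ∈ l, g.IsSwap) ∧ (List.ofFn σ).prod * l.prod = 1 ∧
      l.length = ∑ i, ((σ i).cycleType.sum - Multiset.card (σ i).cycleType) := by
  induction s with
  | zero => exact ⟨[], by simp⟩
  | succ s ih =>
    obtain ⟨l, hl, hprod, hlen⟩ := ih fun i => σ i.succ
    obtain ⟨l', hl', hprod', hlen'⟩ := exists_list_isSwap (σ 0)⁻¹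
    refine ⟨l ++ l', ?_, ?_, ?_⟩
    · simpa [or_imp, forall_and] using ⟨hl, hl'⟩
    · rw [List.ofFn_succ, List.prod_cons, List.prod_append, hprod', mul_assoc, ← mul_assoc _ l.prod,
        hprod, one_mul, mul_inv_cancel]
    · rw [List.length_append, hlen, hlen', Fin.sum_univ_succ, cycleType_inv, add_comm]

/-- For `d ≥ 2`, the identity is a product of `2 * d` transpositions generating `Perm (Fin d)`. -/
theorem exists_list_isSwap_prod_eq_one_closure_eq_top {d : ℕ} (hd : 2 ≤ d) :
    ∃ l : List (Perm (Fin d)), (∀ g ∈ l, g.IsSwap) ∧ l.prod = 1 ∧ l.length = 2 * d ∧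
      Subgroup.closure {g | g ∈ l} = ⊤ := by
  obtain ⟨n, rfl⟩ : ∃ n, d = n + 2 := ⟨d - 2, by omega⟩
  let t : Fin (n + 1) → Perm (Fin (n + 2)) := fun i => swap i.castSucc i.succ
  have ht (i) : (t i).IsSwap := swap_isSwap_iff.2 i.castSucc_lt_succ.ne
  refine ⟨(0 :: List.finRange (n + 1)).flatMap fun i => [t i, t i], ?_, ?_, ?_, ?_⟩
  · intro g hg
    simp only [List.mem_flatMap] at hg
    obtain ⟨i, -, hi⟩ := hg
    have : g = t i := by simpa using hi
    exact this ▸ ht i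
  · rw [List.flatMap_def, List.prod_flatten, List.map_map]
    refine List.prod_eq_one fun x hx => ?_
    obtain ⟨i, -, rfl⟩ := List.mem_map.1 hx
    simpa using (ht i).mul_self
  · simp [List.length_flatMap]
    omega
  · refine top_le_iff.1 ((Subgroup.closure_eq_top_of_mclosure_eq_top
      (mclosure_swap_castSucc_succ (n + 1))).ge.trans (Subgroup.closure_mono ?_))
    rintro _ ⟨i, rfl⟩
    exact List.mem_flatMap.2 ⟨i, by simp, by simp [t]⟩

end Equiv.Perm


/-- For `d ≥ 2`, `s ≥ 1` and partitions `μ₁, …, μ_s` of `d` (each encoded by the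
multiset `m i` of its parts that are `≥ 2`), setting
`R = 2d + ∑ i ((m i).sum - (m i).card)` (equivalently `R = 2d + ∑ i (d - ℓ(μᵢ))`),
there exist permutations `σ₁, …, σ_s` with the prescribed cycle types and `R`
transpositions `τ₁, …, τ_R`, whose ordered product is the identity and which
generate the full symmetric group on `d` letters. -/
theorem hurwitz_factorization_explicit_R
    (d s : ℕ) (hd : 2 ≤ d) (hs : 1 ≤ s)
    (m : Fin s → Multiset ℕ)
    (hm2 : ∀ i, ∀ x ∈ m i, 2 ≤ x)
    (hmsum : ∀ i, (m i).sum ≤ d) :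
    ∃ (σ : Fin s → Equiv.Perm (Fin d))
      (τ : Fin (2 * d + ∑ i, ((m i).sum - Multiset.card (m i))) → Equiv.Perm (Fin d)),
      (∀ i, (σ i).cycleType = m i) ∧
      (∀ j, (τ j).IsSwap) ∧
      (List.ofFn σ).prod * (List.ofFn τ).prod = 1 ∧
      Subgroup.closure (Set.range σ ∪ Set.range τ) = ⊤ := by
  have hσ (i : Fin s) : ∃ f : Equiv.Perm (Fin d), f.cycleType = m i :=
    (Equiv.Perm.exists_with_cycleType_iff _).2 ⟨by simpa using hmsum i, hm2 i⟩
  choose σ hσ using hσ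
  obtain ⟨l, hl, hprod, hlen⟩ := Equiv.Perm.exists_list_isSwap_prod_ofFn_inv σ
  obtain ⟨l', hl', hprod', hlen', hclosure⟩ :=
    Equiv.Perm.exists_list_isSwap_prod_eq_one_closure_eq_top hd
  simp only [hσ] at hlen
  have hL : (l' ++ l).length = 2 * d + ∑ i, ((m i).sum - Multiset.card (m i)) := by
    rw [List.length_append, hlen, hlen']
  rw [← hL]
  refine ⟨σ, (l' ++ l).get, hσ, fun j => ?_, ?_, top_le_iff.1 (hclosure.ge.trans ?_)⟩
  · rcases List.mem_append.1 (List.get_mem (l' ++ l) j) with h | h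
    exacts [hl' _ h, hl _ h]
  · rw [List.ofFn_get, List.prod_append, hprod', one_mul, hprod]
  · refine Subgroup.closure_mono fun g hg => Or.inr ?_
    rw [Set.range_list_get]
    exact List.mem_append_left l hg
end

section
/- Let K₀ be a field equipped with a non-Archimedean (ultrametric) multiplicative absolute value which is nontrivial (there exists a nonzero x ∈ K₀ with |x| ≠ 1). Let L be an algebraic closure of K₀, equipped with a multiplicative ultrametric absolute value extending that of K₀ (i.e., L is a normed field whose norm is nonarchimedean and satisfies ‖algebraMap K₀ L x‖ = ‖x‖ for all x ∈ K₀). Then the separable closure of K₀ inside L (the set of elements of L that are separable over K₀) is dense in L for the topology defined by the absolute value. Equivalently, the separable closure K₀^sep is dense in the completion K of the algebraic closure of K₀. -/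
/-- If `d ^ q ≤ c * (d + b)` with `c` small relative to `ε`, then `d < ε`. -/
theorem lt_of_pow_le_mul_add {d b c ε : ℝ} {q : ℕ} (hq : q ≠ 0) (hb : 0 ≤ b) (hε : 0 < ε)
    (hc : c < ε ^ q / (ε + b)) (h : d ^ q ≤ c * (d + b)) : d < ε := by
  by_contra! hd
  obtain ⟨m, rfl⟩ := Nat.exists_eq_succ_of_ne_zero hq
  have hd0 : 0 < d := hε.trans_le hd
  have hc' : c * (ε + b) < ε ^ (m + 1) := (lt_div_iff₀ (by positivity)).1 hc
  have hm : ε ^ m ≤ d ^ m := pow_le_pow_left₀ hε.le hd m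
  have hm1 : ε ^ (m + 1) ≤ d ^ (m + 1) := pow_le_pow_left₀ hε.le hd _
  have h1 : ε ^ (m + 1) * d ≤ d ^ (m + 1) * ε := by
    have := mul_le_mul_of_nonneg_right hm (mul_pos hε hd0).le
    rw [pow_succ, pow_succ]
    linarith
  have h2 : ε ^ (m + 1) * b ≤ d ^ (m + 1) * b := mul_le_mul_of_nonneg_right hm1 hb
  have h3 : d ^ (m + 1) * (ε + b) ≤ c * (d + b) * (ε + b) :=
    mul_le_mul_of_nonneg_right h (by positivity)
  have h4 : c * (ε + b) * (d + b) < ε ^ (m + 1) * (d + b) :=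
    mul_lt_mul_of_pos_right hc' (by positivity)
  linarith

/-- A normed field with a nontrivial norm has nonzero elements of arbitrarily small norm. -/
theorem NormedField.exists_ne_zero_norm_lt_of_nontrivial {K : Type*} [NormedField K]
    (h : ∃ x : K, x ≠ 0 ∧ ‖x‖ ≠ 1) {δ : ℝ} (hδ : 0 < δ) : ∃ c : K, c ≠ 0 ∧ ‖c‖ < δ := by
  obtain ⟨x, hx0, hx1⟩ := h
  obtain ⟨y, hy0, hy1⟩ : ∃ y : K, y ≠ 0 ∧ ‖y‖ < 1 := by
    rcases lt_or_gt_of_ne hx1 with hx | hx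
    · exact ⟨x, hx0, hx⟩
    · exact ⟨x⁻¹, inv_ne_zero hx0, by rw [norm_inv]; exact inv_lt_one_of_one_lt₀ hx⟩
  obtain ⟨n, hn⟩ := exists_pow_lt_of_lt_one hδ hy1
  exact ⟨y ^ n, pow_ne_zero n hy0, by rwa [norm_pow]⟩


/-- Let `K₀` be a field with a nontrivial non-Archimedean multiplicative absolute value
(a nontrivial ultrametric norm), and let `L` be an algebraic closure of `K₀` equipped
with a multiplicative ultrametric absolute value extending that of `K₀`.  Then the
separable closure of `K₀` inside `L` is dense in `L` (equivalently, `K₀^sep` is dense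
in the completion of the algebraic closure of `K₀`). -/
theorem separableClosure_dense_of_nontrivial_nonarchimedean
    (K₀ L : Type*) [NormedField K₀] [NormedField L]
    [Algebra K₀ L] [IsAlgClosure K₀ L]
    (h_na₀ : ∀ x y : K₀, ‖x + y‖ ≤ max ‖x‖ ‖y‖)
    (h_na : ∀ x y : L, ‖x + y‖ ≤ max ‖x‖ ‖y‖)
    (h_ext : ∀ x : K₀, ‖algebraMap K₀ L x‖ = ‖x‖)
    (h_nontriv : ∃ x : K₀, x ≠ 0 ∧ ‖x‖ ≠ 1) :
    Dense (separableClosure K₀ L : Set L) := by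
  have : IsAlgClosed L := IsAlgClosure.isAlgClosed K₀
  have : Algebra.IsAlgebraic K₀ L := IsAlgClosure.isAlgebraic
  obtain ⟨p, _⟩ := ExpChar.exists K₀
  have : ExpChar L p := expChar_of_injective_algebraMap (algebraMap K₀ L).injective p
  have : IsSepClosed (separableClosure K₀ L) := IsSepClosure.sep_closed K₀
  rw [Metric.dense_iff]
  intro x ε hε
  have : ExpChar (separableClosure K₀ L) p :=
    expChar_of_injective_algebraMap (algebraMap K₀ (separableClosure K₀ L)).injective p
  obtain ⟨n, a, ha⟩ := IsPurelyInseparable.pow_mem (separableClosure K₀ L) p x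
  have hx : x ^ p ^ n = (a : L) := ha.symm
  by_cases hq : p ^ n = 1
  · refine ⟨x, Metric.mem_ball_self hε, ?_⟩
    rw [hq, pow_one] at hx
    exact hx ▸ a.2
  have hn : n ≠ 0 := by rintro rfl; exact hq (pow_zero p)
  have hp : p ≠ 1 := by rintro rfl; exact hq (one_pow n)
  have hprime : p.Prime := (expChar_is_prime_or_one K₀ p).resolve_right hp
  have : CharP (separableClosure K₀ L) p := by
    rcases ‹ExpChar (separableClosure K₀ L) p› with _ | _
    · exact absurd rfl hp
    · assumption
  have hq0 : p ^ n ≠ 0 := pow_ne_zero n hprime.ne_zero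
  have hq2 : 1 < p ^ n := by omega
  obtain ⟨c, hc0, hc⟩ := NormedField.exists_ne_zero_norm_lt_of_nontrivial h_nontriv
    (δ := ε ^ p ^ n / (ε + ‖x‖)) (by positivity)
  obtain ⟨y, hy⟩ := IsSepClosed.exists_root_C_mul_X_pow_add_C_mul_X_add_C' p (p ^ n) 1
    (-algebraMap K₀ (separableClosure K₀ L) c) (-a) (dvd_pow_self p hn) (by omega) (by simpa using hc0)
  refine ⟨y, ?_, y.2⟩
  have hy' : (y : L) ^ p ^ n - a = algebraMap K₀ L c * y := by
    have := congrArg (algebraMap (separableClosure K₀ L) L) hy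
    simp only [map_add, map_mul, map_neg, map_pow, map_one, map_zero,
      ← IsScalarTower.algebraMap_apply] at this
    change 1 * (y : L) ^ p ^ n + -algebraMap K₀ L c * y + -a = 0 at this
    linear_combination this
  rw [mem_ball_iff_norm]
  refine lt_of_pow_le_mul_add hq0 (norm_nonneg x) hε hc ?_
  rw [← norm_pow, sub_pow_expChar_pow, hx, hy', norm_mul, h_ext]
  gcongr
  simpa using norm_add_le ((y : L) - x) x
end
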